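/- Let B be a Bol superalgebra over a field K of characteristic 0, let PS(B) be the Lie superalgebra of pairs (P,a) of pseudo superderivations with companions, let IPS(B,B) ⊆ PS(B) be the graded span of the pairs (D_{x,y}, x·y) for homogeneous x,y ∈ B, and let H = H₀ ⊕ H₁ be a Lie subsuperalgebra of PS(B) with IPS(B,B) ⊆ H. Then the Z₂-graded space L^H(B) = B ⊕ H, graded by L^H(B)ᵢ = Bᵢ ⊕ Hᵢ and equipped with the bracket determined by [x,y] := (D_{x,y}, x·y), [(P,a),x] := −(−1)^{|a||x|}[x,(P,a)] := P(x), and [(P,a),(Q,b)] := (P∘Q − (−1)^{|a||b|}Q∘P, P(b) − (−1)^{|a||b|}Q(a) − a·b) for homogeneous x,y ∈ B and homogeneous (P,a),(Q,b) ∈ H, is a Lie superalgebra. -/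

import Mathlib

open LinearMap

/-- The sign `(-1)^(i·j)` in the ground field, for parities `i j : ZMod 2`. -/
def sgn (K : Type*) [Field K] (i j : ZMod 2) : K := (-1 : K) ^ (i * j).val

/-- A Bol superalgebra over `K`: a `ZMod 2`-graded vector space with a bilinear
product `mul` and a trilinear bracket `tri` satisfying (BS1)–(BS5) on
homogeneous elements. -/
structure BolSuper (K : Type*) (B : Type*) [Field K] [AddCommGroup B] [Module K B] where
  g : ZMod 2 → Submodule K B
  internal : DirectSum.IsInternal g
  mul : B →ₗ[K] B →ₗ[K] B
  tri : B →ₗ[K] B →ₗ[K] B →ₗ[K] B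
  mul_mem : ∀ i j x y, x ∈ g i → y ∈ g j → mul x y ∈ g (i + j)
  tri_mem : ∀ i j k x y z, x ∈ g i → y ∈ g j → z ∈ g k → tri x y z ∈ g (i + j + k)
  bs1 : ∀ i j x y, x ∈ g i → y ∈ g j → mul x y = -(sgn K i j • mul y x)
  bs2 : ∀ i j k x y z, x ∈ g i → y ∈ g j → z ∈ g k → tri x y z = -(sgn K i j • tri y x z)
  bs3 : ∀ i j k x y z, x ∈ g i → y ∈ g j → z ∈ g k →
    tri x y z + sgn K i (j + k) • tri y z x + sgn K k (i + j) • tri z x y = 0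
  bs4 : ∀ i j k l m x y u v w, x ∈ g i → y ∈ g j → u ∈ g k → v ∈ g l → w ∈ g m →
    tri x y (tri u v w) = tri (tri x y u) v w + sgn K k (i + j) • tri u (tri x y v) w
      + sgn K (i + j) (k + l) • tri u v (tri x y w)
  bs5 : ∀ i j k l x y u v, x ∈ g i → y ∈ g j → u ∈ g k → v ∈ g l →
    tri x y (mul u v) = sgn K k (i + j) • mul u (tri x y v) + mul (tri x y u) v
      + sgn K (i + j) (k + l) • tri u v (mul x y) + mul (mul x y) (mul u v)

variable {K B L : Type*} [Field K] [AddCommGroup B] [Module K B]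

/-- `P` is a pseudo superderivation of degree `r` of the Bol superalgebra `A`
with companion `a ∈ A.g r`. -/
def IsPSD (A : BolSuper K B) (r : ZMod 2) (P : B →ₗ[K] B) (a : B) : Prop :=
  a ∈ A.g r ∧
  (∀ i x, x ∈ A.g i → P x ∈ A.g (i + r)) ∧
  (∀ i j k x y z, x ∈ A.g i → y ∈ A.g j → z ∈ A.g k →
    P (A.tri x y z) = A.tri (P x) y z + sgn K r i • A.tri x (P y) z
      + sgn K r (i + j) • A.tri x y (P z)) ∧
  (∀ i j x y, x ∈ A.g i → y ∈ A.g j →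
    P (A.mul x y) = sgn K r i • A.mul x (P y) + A.mul (P x) y
      + sgn K r (i + j) • A.tri x y a + A.mul a (A.mul x y))

/-- The bracket on pairs (pseudo superderivation, companion), for degrees `r`, `s`. -/
def pbrk (A : BolSuper K B) (r s : ZMod 2)
    (pa qb : (B →ₗ[K] B) × B) : (B →ₗ[K] B) × B :=
  (pa.1 ∘ₗ qb.1 - sgn K r s • (qb.1 ∘ₗ pa.1),
   pa.1 qb.2 - sgn K r s • qb.1 pa.2 - A.mul pa.2 qb.2)

/-- The bracket on `B ⊕ H` (elements encoded as pairs `(x, (P, a))`),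
for degrees `r`, `s`. -/
def lbrk (A : BolSuper K B) (r s : ZMod 2)
    (u v : B × ((B →ₗ[K] B) × B)) : B × ((B →ₗ[K] B) × B) :=
  (u.2.1 v.1 - sgn K r s • v.2.1 u.1,
   (A.tri u.1 v.1 + (pbrk A r s u.2 v.2).1,
    A.mul u.1 v.1 + (pbrk A r s u.2 v.2).2))

/-- The degree-`r` part of the span of the inner pairs `(D_{x,u}, x·u)` with
`x` homogeneous in `B` and `u` homogeneous in the graded subspace `S`. -/
def IPSpan (A : BolSuper K B) (S : ZMod 2 → Submodule K B) (r : ZMod 2) :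
    Submodule K ((B →ₗ[K] B) × B) :=
  Submodule.span K {pa | ∃ i j x u, i + j = r ∧ x ∈ A.g i ∧ u ∈ S j ∧
    pa = (A.tri x u, A.mul x u)}

/-- Data presenting a Lie superalgebra `L` as the standard enveloping Lie
superalgebra `L(B) = B ⊕ IPS(B,B)` of the Bol superalgebra `A`, together with
the grading involution `sigma` used to define supertraces. -/
structure EnvSetup (K B L : Type*) [Field K] [AddCommGroup B] [Module K B]
    [AddCommGroup L] [Module K L] (A : BolSuper K B) where
  brk : L →ₗ[K] L →ₗ[K] L
  iota : B →ₗ[K] L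
  jmap : ((B →ₗ[K] B) × B) →ₗ[K] L
  gL : ZMod 2 → Submodule K L
  gL_eq : ∀ r, gL r = (A.g r).map iota ⊔ (IPSpan A A.g r).map jmap
  surj : ∀ v : L, ∃ x pa, pa ∈ IPSpan A A.g 0 ⊔ IPSpan A A.g 1 ∧ v = iota x + jmap pa
  inj : ∀ x pa, pa ∈ IPSpan A A.g 0 ⊔ IPSpan A A.g 1 → iota x + jmap pa = 0 →
    x = 0 ∧ pa = 0
  brk_bb : ∀ x y : B, brk (iota x) (iota y) = jmap (A.tri x y, A.mul x y)
  brk_pb : ∀ r pa, pa ∈ IPSpan A A.g r → ∀ x : B, brk (jmap pa) (iota x) = iota (pa.1 x)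
  brk_bp : ∀ r s x pa, x ∈ A.g r → pa ∈ IPSpan A A.g s →
    brk (iota x) (jmap pa) = -(sgn K r s • iota (pa.1 x))
  brk_pp : ∀ r s pa qb, pa ∈ IPSpan A A.g r → qb ∈ IPSpan A A.g s →
    brk (jmap pa) (jmap qb) = jmap (pbrk A r s pa qb)
  sigma : L →ₗ[K] L
  sigma0 : ∀ v ∈ gL 0, sigma v = v
  sigma1 : ∀ v ∈ gL 1, sigma v = -v

variable [AddCommGroup L] [Module K L]

/-- The Killing form `α(u,v) = str(ad u ∘ ad v)` of the enveloping Lie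
superalgebra, the supertrace being computed via the grading involution. -/
noncomputable def killing {A : BolSuper K B} (E : EnvSetup K B L A) (u v : L) : K :=
  LinearMap.trace K L (E.sigma ∘ₗ E.brk u ∘ₗ E.brk v)

/-- The Killing-Ricci form of `B`: the restriction of the Killing form of the
standard enveloping Lie superalgebra to `B × B`. -/
noncomputable def kr {A : BolSuper K B} (E : EnvSetup K B L A) (x y : B) : K :=
  killing E (E.iota x) (E.iota y)

theorem sgn_add_right (K : Type*) [Field K] (i j k : ZMod 2) :
    sgn K i (j + k) = sgn K i j * sgn K i k := by
  rw [sgn, mul_add, ZMod.val_add, ← neg_one_pow_eq_pow_mod_two, pow_add, sgn, sgn]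

theorem sgn_comm (K : Type*) [Field K] (i j : ZMod 2) : sgn K i j = sgn K j i := by
  rw [sgn, sgn, mul_comm]

theorem sgn_add_left (K : Type*) [Field K] (i j k : ZMod 2) :
    sgn K (i + j) k = sgn K i k * sgn K j k := by
  rw [sgn_comm, sgn_add_right, sgn_comm K k i, sgn_comm K k j]

theorem sgn_eq_one_or (K : Type*) [Field K] (i j : ZMod 2) : sgn K i j = 1 ∨ sgn K i j = -1 :=
  neg_one_pow_eq_or K _

namespace BolSuper

variable {M : Type*} [AddCommGroup M] [Module K M]

theorem hom_ext (A : BolSuper K B) {f f' : B →ₗ[K] M}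
    (h : ∀ i, ∀ x ∈ A.g i, f x = f' x) : f = f' := by
  ext x
  have hx : x ∈ iSup A.g := A.internal.submodule_iSup_eq_top ▸ Submodule.mem_top
  induction hx using Submodule.iSup_induction' with
  | mem i x hx => exact h i x hx
  | zero => simp
  | add x y _ _ hx hy => simp [hx, hy]

theorem tri_skew (A : BolSuper K B) {i j : ZMod 2} {x y : B} (hx : x ∈ A.g i) (hy : y ∈ A.g j) :
    A.tri x y = -(sgn K i j • A.tri y x) :=
  A.hom_ext fun k z hz => by simpa using A.bs2 i j k x y z hx hy hz

end BolSuper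

namespace IsPSD

variable {A : BolSuper K B} {r : ZMod 2} {P : B →ₗ[K] B} {a : B}

theorem comp_tri (h : IsPSD A r P a) {i j : ZMod 2} {x y : B} (hx : x ∈ A.g i) (hy : y ∈ A.g j) :
    P ∘ₗ A.tri x y = A.tri (P x) y + sgn K r i • A.tri x (P y)
      + sgn K r (i + j) • (A.tri x y ∘ₗ P) :=
  A.hom_ext fun k z hz => by simpa using h.2.2.1 i j k x y z hx hy hz

theorem map_mem (h : IsPSD A r P a) {i : ZMod 2} {x : B} (hx : x ∈ A.g i) : P x ∈ A.g (r + i) :=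
  add_comm i r ▸ h.2.1 i x hx

end IsPSD

section Bracket

variable (A : BolSuper K B) (H : ZMod 2 → Submodule K ((B →ₗ[K] B) × B))

theorem lbrk_mem
    (hH_psd : ∀ r pa, pa ∈ H r → IsPSD A r pa.1 pa.2)
    (hH_brk : ∀ r s pa qb, pa ∈ H r → qb ∈ H s → pbrk A r s pa qb ∈ H (r + s))
    (hH_ips : ∀ i j x y, x ∈ A.g i → y ∈ A.g j → (A.tri x y, A.mul x y) ∈ H (i + j))
    {r s : ZMod 2} {u v : B × ((B →ₗ[K] B) × B)}
    (hu : u.1 ∈ A.g r) (hu' : u.2 ∈ H r) (hv : v.1 ∈ A.g s) (hv' : v.2 ∈ H s) :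
    (lbrk A r s u v).1 ∈ A.g (r + s) ∧ (lbrk A r s u v).2 ∈ H (r + s) := by
  refine ⟨sub_mem ((hH_psd r _ hu').map_mem hv) (Submodule.smul_mem _ _ ?_),
    add_mem (hH_ips r s _ _ hu hv) (hH_brk r s _ _ hu' hv')⟩
  exact (hH_psd s _ hv').2.1 r _ hu

theorem lbrk_skew {r s : ZMod 2} {u v : B × ((B →ₗ[K] B) × B)}
    (hu : u.1 ∈ A.g r) (hu' : IsPSD A r u.2.1 u.2.2)
    (hv : v.1 ∈ A.g s) (hv' : IsPSD A s v.2.1 v.2.2) :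
    lbrk A r s u v = -(sgn K r s • lbrk A s r v u) := by
  have hxy := A.bs1 r s _ _ hu hv
  have hab := A.bs1 r s _ _ hu'.1 hv'.1
  have hD := A.tri_skew hu hv
  have hs : sgn K r s * sgn K r s = 1 := by
    rcases sgn_eq_one_or K r s with h | h <;> simp [h]
  simp only [lbrk, pbrk, sgn_comm K s r, hxy, hab, hD]
  ext <;> simp [smul_sub, smul_smul, hs] <;> abel

theorem lbrk_jacobi_fst {r s t : ZMod 2} {u v w : B × ((B →ₗ[K] B) × B)}
    (hu : u.1 ∈ A.g r) (hv : v.1 ∈ A.g s) (hw : w.1 ∈ A.g t) :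
    (lbrk A (r + s) t (lbrk A r s u v) w
        + sgn K r (s + t) • lbrk A (s + t) r (lbrk A s t v w) u
        + sgn K t (r + s) • lbrk A (t + r) s (lbrk A t r w u) v).1 = 0 := by
  obtain ⟨x, P, a⟩ := u
  obtain ⟨y, Q, b⟩ := v
  obtain ⟨z, R, c⟩ := w
  have h := A.bs3 r s t x y z hu hv hw
  simp only [lbrk, pbrk, sgn_add_left, sgn_add_right, sgn_comm K s r, sgn_comm K t r,
    sgn_comm K t s, Prod.fst_add, Prod.smul_fst, LinearMap.add_apply, LinearMap.sub_apply,
    LinearMap.smul_apply, LinearMap.comp_apply, map_sub, map_smul] at h ⊢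
  rcases sgn_eq_one_or K r s with h₁ | h₁ <;> rcases sgn_eq_one_or K s t with h₂ | h₂ <;>
    rcases sgn_eq_one_or K r t with h₃ | h₃ <;> simp only [h₁, h₂, h₃] at h ⊢ <;>
    linear_combination (norm := module) h

theorem lbrk_jacobi_snd_fst {r s t : ZMod 2} {u v w : B × ((B →ₗ[K] B) × B)}
    (hu : u.1 ∈ A.g r) (hu' : IsPSD A r u.2.1 u.2.2)
    (hv : v.1 ∈ A.g s) (hv' : IsPSD A s v.2.1 v.2.2)
    (hw : w.1 ∈ A.g t) (hw' : IsPSD A t w.2.1 w.2.2) :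
    (lbrk A (r + s) t (lbrk A r s u v) w
        + sgn K r (s + t) • lbrk A (s + t) r (lbrk A s t v w) u
        + sgn K t (r + s) • lbrk A (t + r) s (lbrk A t r w u) v).2.1 = 0 := by
  obtain ⟨x, P, a⟩ := u
  obtain ⟨y, Q, b⟩ := v
  obtain ⟨z, R, c⟩ := w
  have hP := hu'.comp_tri hv hw
  have hQ := hv'.comp_tri hw hu
  have hR := hw'.comp_tri hu hv
  have sP := A.tri_skew (hu'.map_mem hw) hv
  have sQ := A.tri_skew (hv'.map_mem hu) hw
  have sR := A.tri_skew (hw'.map_mem hv) hu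
  simp only [lbrk, pbrk, sgn_add_left, sgn_add_right, sgn_comm K s r, sgn_comm K t r,
    sgn_comm K t s, Prod.fst_add, Prod.snd_add, Prod.smul_fst, Prod.smul_snd,
    LinearMap.add_comp, LinearMap.sub_comp, LinearMap.comp_add, LinearMap.comp_sub,
    LinearMap.smul_comp, LinearMap.comp_smul, LinearMap.add_apply, LinearMap.sub_apply,
    LinearMap.smul_apply, LinearMap.comp_assoc, map_sub, map_smul] at hP hQ hR sP sQ sR ⊢
  rw [hP, hQ, hR, sP, sQ, sR]
  rcases sgn_eq_one_or K r s with h₁ | h₁ <;> rcases sgn_eq_one_or K s t with h₂ | h₂ <;>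
    rcases sgn_eq_one_or K r t with h₃ | h₃ <;> simp only [h₁, h₂, h₃] <;> module

set_option maxHeartbeats 1600000 in
theorem lbrk_jacobi_snd_snd {r s t : ZMod 2} {u v w : B × ((B →ₗ[K] B) × B)}
    (hu : u.1 ∈ A.g r) (hu' : IsPSD A r u.2.1 u.2.2)
    (hv : v.1 ∈ A.g s) (hv' : IsPSD A s v.2.1 v.2.2)
    (hw : w.1 ∈ A.g t) (hw' : IsPSD A t w.2.1 w.2.2) :
    (lbrk A (r + s) t (lbrk A r s u v) w
        + sgn K r (s + t) • lbrk A (s + t) r (lbrk A s t v w) u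
        + sgn K t (r + s) • lbrk A (t + r) s (lbrk A t r w u) v).2.2 = 0 := by
  obtain ⟨x, P, a⟩ := u
  obtain ⟨y, Q, b⟩ := v
  obtain ⟨z, R, c⟩ := w
  have ha := hu'.1
  have hb := hv'.1
  have hc := hw'.1
  have h3 := A.bs3 r s t a b c ha hb hc
  have hP := hu'.2.2.2 s t y z hv hw
  have hQ := hv'.2.2.2 t r z x hw hu
  have hR := hw'.2.2.2 r s x y hu hv
  have hP' := hu'.2.2.2 s t b c hb hc
  have hQ' := hv'.2.2.2 t r c a hc ha
  have hR' := hw'.2.2.2 r s a b ha hb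
  have mP := A.bs1 _ _ _ _ (A.mul_mem _ _ _ _ hv hw) ha
  have mQ := A.bs1 _ _ _ _ (A.mul_mem _ _ _ _ hw hu) hb
  have mR := A.bs1 _ _ _ _ (A.mul_mem _ _ _ _ hu hv) hc
  have mP' := A.bs1 _ _ _ _ (A.mul_mem _ _ _ _ hb hc) ha
  have mQ' := A.bs1 _ _ _ _ (A.mul_mem _ _ _ _ hc ha) hb
  have mR' := A.bs1 _ _ _ _ (A.mul_mem _ _ _ _ ha hb) hc
  have sP := A.bs1 _ _ _ _ (hu'.map_mem hw) hv
  have sQ := A.bs1 _ _ _ _ (hv'.map_mem hu) hw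
  have sR := A.bs1 _ _ _ _ (hw'.map_mem hv) hu
  have sP' := A.bs1 _ _ _ _ (hu'.map_mem hc) hb
  have sQ' := A.bs1 _ _ _ _ (hv'.map_mem ha) hc
  have sR' := A.bs1 _ _ _ _ (hw'.map_mem hb) ha
  simp only [lbrk, pbrk, sgn_add_left, sgn_add_right, sgn_comm K s r, sgn_comm K t r,
    sgn_comm K t s, Prod.snd_add, Prod.smul_snd, LinearMap.add_apply, LinearMap.sub_apply,
    LinearMap.smul_apply, LinearMap.comp_apply, map_add, map_sub, map_smul]
    at h3 hP hQ hR hP' hQ' hR' mP mQ mR mP' mQ' mR' sP sQ sR sP' sQ' sR' ⊢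
  rw [hP, hQ, hR, hP', hQ', hR', mP, mQ, mR, mP', mQ', mR', sP, sQ, sR, sP', sQ', sR']
  rcases sgn_eq_one_or K r s with h₁ | h₁ <;> rcases sgn_eq_one_or K s t with h₂ | h₂ <;>
    rcases sgn_eq_one_or K r t with h₃ | h₃ <;> simp only [h₁, h₂, h₃] at h3 ⊢ <;>
    linear_combination (norm := module) h3

end Bracket

/-- for any Lie subsuperalgebra `H` of `PS(B)` containing
`IPS(B,B)`, the space `L^H(B) = B ⊕ H` (elements encoded as pairs `(x,(P,a))`)
with the bracket `lbrk` is a Lie superalgebra: the bracket respects the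
grading, is super skew-symmetric and satisfies the super Jacobi identity on
homogeneous elements. -/
theorem stmt4 {K B : Type*} [Field K] [CharZero K] [AddCommGroup B] [Module K B]
    (A : BolSuper K B) (H : ZMod 2 → Submodule K ((B →ₗ[K] B) × B))
    (hH_psd : ∀ r pa, pa ∈ H r → IsPSD A r pa.1 pa.2)
    (hH_brk : ∀ r s pa qb, pa ∈ H r → qb ∈ H s → pbrk A r s pa qb ∈ H (r + s))
    (hH_ips : ∀ i j x y, x ∈ A.g i → y ∈ A.g j → (A.tri x y, A.mul x y) ∈ H (i + j)) :
    (∀ (r s : ZMod 2) (u v : B × ((B →ₗ[K] B) × B)),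
      u.1 ∈ A.g r → u.2 ∈ H r → v.1 ∈ A.g s → v.2 ∈ H s →
      (lbrk A r s u v).1 ∈ A.g (r + s) ∧ (lbrk A r s u v).2 ∈ H (r + s)) ∧
    (∀ (r s : ZMod 2) (u v : B × ((B →ₗ[K] B) × B)),
      u.1 ∈ A.g r → u.2 ∈ H r → v.1 ∈ A.g s → v.2 ∈ H s →
      lbrk A r s u v = -(sgn K r s • lbrk A s r v u)) ∧
    (∀ (r s t : ZMod 2) (u v w : B × ((B →ₗ[K] B) × B)),
      u.1 ∈ A.g r → u.2 ∈ H r → v.1 ∈ A.g s → v.2 ∈ H s → w.1 ∈ A.g t → w.2 ∈ H t →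
      lbrk A (r + s) t (lbrk A r s u v) w
        + sgn K r (s + t) • lbrk A (s + t) r (lbrk A s t v w) u
        + sgn K t (r + s) • lbrk A (t + r) s (lbrk A t r w u) v = 0) := by
  refine ⟨fun r s u v => lbrk_mem A H hH_psd hH_brk hH_ips, fun r s u v hu hu' hv hv' =>
    lbrk_skew A hu (hH_psd r _ hu') hv (hH_psd s _ hv'), fun r s t u v w hu hu' hv hv' hw hw' => ?_⟩
  replace hu' := hH_psd r _ hu'
  replace hv' := hH_psd s _ hv'
  replace hw' := hH_psd t _ hw'
  exact Prod.ext (lbrk_jacobi_fst A hu hv hw) (Prod.ext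
    (lbrk_jacobi_snd_fst A hu hu' hv hv' hw hw') (lbrk_jacobi_snd_snd A hu hu' hv hv' hw hw'))
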